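/- arXiv:math/0302060 — 2 statements merged into one kernel-verified Lean document; each statement's English description precedes it below -/
import Mathlib

section
/- Let n ≥ 1 and let V = ℂ². For each i with 1 ≤ i ≤ n-1, let h_i : V^{⊗n} → V^{⊗(n-2)} be the contraction that applies the determinant form ω (ω(v, w) = v₁w₂ - v₂w₁) to the i-th and (i+1)-st tensor factors and leaves the remaining factors in order. Then the intersection ⋂_{i=1}^{n-1} ker(h_i) equals the subspace of symmetric tensors in V^{⊗n} (the fixed points of the permutation action of the symmetric group Sₙ on tensor factors), and this subspace has dimension n + 1. (This computes H⁰(C_n) ≅ Sym^n(V_1) ≅ V_n.) -/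
/-! We model the tensor power `V^{⊗n}` of `V = ℂ²` as the space
`(Fin n → Fin 2) → ℂ` of coefficient functions with respect to the standard
basis `e_{a₁} ⊗ ⋯ ⊗ e_{aₙ}`, `a : Fin n → Fin 2`. -/

/-- Insertion of values `x` at position `i` and `y` at position `i+1`
(0-indexed) into a multi-index with `n - 2` entries, producing a multi-index
with `n` entries. -/
def insertAt (n : ℕ) (i : Fin (n - 1)) (x y : Fin 2) (b : Fin (n - 2) → Fin 2) :
    Fin n → Fin 2 := fun j =>
  if h1 : j.val < i.val then b ⟨j.val, by have := i.isLt; omega⟩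
  else if h2 : j.val = i.val then x
  else if h3 : j.val = i.val + 1 then y
  else b ⟨j.val - 2, by have := i.isLt; have := j.isLt; omega⟩

/-- The contraction `h_i : V^{⊗n} → V^{⊗(n-2)}` applying the determinant form
`ω(v, w) = v₁w₂ - v₂w₁` to the tensor factors in positions `i`, `i+1` and
keeping the remaining factors in order: on coefficients,
`(h_i T)_b = T_{b with (0,1) inserted at i} - T_{b with (1,0) inserted at i}`. -/
def contractPos (n : ℕ) (i : Fin (n - 1)) :
    ((Fin n → Fin 2) → ℂ) →ₗ[ℂ] ((Fin (n - 2) → Fin 2) → ℂ) where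
  toFun T := fun b => T (insertAt n i 0 1 b) - T (insertAt n i 1 0 b)
  map_add' T S := by funext b; simp only [Pi.add_apply]; ring
  map_smul' c T := by funext b; simp only [Pi.smul_apply, smul_eq_mul, RingHom.id_apply]; ring

/-- The action of a permutation `σ ∈ Sₙ` on `V^{⊗n}`, permuting tensor factors. -/
def permMap (n : ℕ) (σ : Equiv.Perm (Fin n)) :
    ((Fin n → Fin 2) → ℂ) →ₗ[ℂ] ((Fin n → Fin 2) → ℂ) where
  toFun T := fun a => T (a ∘ σ)
  map_add' _ _ := rfl
  map_smul' _ _ := rfl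

/-- The subspace of symmetric tensors in `V^{⊗n}`: the fixed points of the
permutation action of the symmetric group `Sₙ` on tensor factors. -/
noncomputable def symmTensors (n : ℕ) : Submodule ℂ ((Fin n → Fin 2) → ℂ) :=
  ⨅ σ : Equiv.Perm (Fin n), LinearMap.ker (permMap n σ - LinearMap.id)

theorem mem_symmTensors {n : ℕ} {T : (Fin n → Fin 2) → ℂ} :
    T ∈ symmTensors n ↔ ∀ (σ : Equiv.Perm (Fin n)) (a : Fin n → Fin 2), T (a ∘ σ) = T a := by
  simp [symmTensors, sub_eq_zero, permMap, funext_iff]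

theorem mem_iInf_ker_contractPos {n : ℕ} {T : (Fin n → Fin 2) → ℂ} :
    T ∈ (⨅ i : Fin (n - 1), LinearMap.ker (contractPos n i)) ↔
      ∀ (i : Fin (n - 1)) (b : Fin (n - 2) → Fin 2),
        T (insertAt n i 0 1 b) = T (insertAt n i 1 0 b) := by
  simp [sub_eq_zero, contractPos, funext_iff]

theorem insertAt_comp_swap {m : ℕ} (i : Fin m) (x y : Fin 2) (b : Fin (m + 1 - 2) → Fin 2) :
    insertAt (m + 1) i x y b ∘ Equiv.swap i.castSucc i.succ = insertAt (m + 1) i y x b := by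
  funext j
  rcases eq_or_ne j i.castSucc with rfl | hj
  · simp [insertAt]
  rcases eq_or_ne j i.succ with rfl | hj'
  · simp [insertAt]
  have h : j.val ≠ i.val := fun h => hj (Fin.ext h)
  have h' : j.val ≠ i.val + 1 := fun h => hj' (Fin.ext h)
  simp [insertAt, Equiv.swap_apply_of_ne_of_ne hj hj', h, h']

theorem exists_eq_insertAt {m : ℕ} (i : Fin m) (a : Fin (m + 1) → Fin 2) :
    ∃ b : Fin (m + 1 - 2) → Fin 2,
      a = insertAt (m + 1) i (a i.castSucc) (a i.succ) b := by
  refine ⟨fun j => if j.val < i.val then a ⟨j.val, by omega⟩ else a ⟨j.val + 2, by omega⟩, ?_⟩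
  funext j
  unfold insertAt
  split_ifs with h₁ h₂ h₃
  · simp [h₁]
  · exact congrArg a (Fin.ext h₂)
  · exact congrArg a (Fin.ext h₃)
  · have h : ¬ j.val - 2 < i.val := by omega
    simp only [h, if_false]
    exact congrArg a (Fin.ext (by simp only; omega))

/-- Lying in the kernel of `h_i` amounts to invariance under the transposition of the adjacent
factors `i`, `i + 1`. -/
theorem apply_comp_swap_of_contract {m : ℕ} {T : (Fin (m + 1) → Fin 2) → ℂ} (i : Fin m)
    (hT : ∀ b : Fin (m + 1 - 2) → Fin 2,
      T (insertAt (m + 1) i 0 1 b) = T (insertAt (m + 1) i 1 0 b))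
    (a : Fin (m + 1) → Fin 2) : T (a ∘ Equiv.swap i.castSucc i.succ) = T a := by
  obtain ⟨b, hb⟩ := exists_eq_insertAt i a
  generalize a i.castSucc = x, a i.succ = y at hb
  subst hb
  rw [insertAt_comp_swap]
  fin_cases x <;> fin_cases y
  · rfl
  · exact (hT b).symm
  · exact hT b
  · rfl

theorem apply_comp_perm_of_swap {m : ℕ} {T : (Fin (m + 1) → Fin 2) → ℂ}
    (hT : ∀ (i : Fin m) (a : Fin (m + 1) → Fin 2),
      T (a ∘ Equiv.swap i.castSucc i.succ) = T a)
    (σ : Equiv.Perm (Fin (m + 1))) (a : Fin (m + 1) → Fin 2) : T (a ∘ σ) = T a := by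
  have hσ : σ ∈ Submonoid.closure
      (Set.range fun i : Fin m => Equiv.swap i.castSucc i.succ) := by
    rw [Equiv.Perm.mclosure_swap_castSucc_succ]
    trivial
  induction hσ using Submonoid.closure_induction generalizing a with
  | mem σ h =>
    obtain ⟨i, rfl⟩ := h
    exact hT i a
  | one => rfl
  | mul σ τ _ _ hσ hτ =>
    rw [Equiv.Perm.coe_mul, ← Function.comp_assoc, hτ, hσ]

theorem iInf_ker_contractPos_eq_symmTensors (m : ℕ) :
    (⨅ i : Fin (m + 1 - 1), LinearMap.ker (contractPos (m + 1) i)) = symmTensors (m + 1) := by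
  ext T
  rw [mem_iInf_ker_contractPos, mem_symmTensors]
  refine ⟨fun h => apply_comp_perm_of_swap fun i => apply_comp_swap_of_contract i (h i),
    fun h i b => ?_⟩
  rw [← h (Equiv.swap (Fin.castSucc (n := m) i) (Fin.succ (n := m) i)) (insertAt _ i 0 1 b),
    insertAt_comp_swap]

/-- The number of entries of a multi-index equal to `1`. -/
def indexWeight {n : ℕ} (a : Fin n → Fin 2) : Fin (n + 1) :=
  ⟨Fintype.card {j // a j = 1}, Nat.lt_succ_of_le (by
    simpa using Fintype.card_subtype_le fun j => a j = 1)⟩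

/-- The multi-index `(1, …, 1, 0, …, 0)` with `k` entries equal to `1`. -/
def stdIndex {n : ℕ} (k : Fin (n + 1)) : Fin n → Fin 2 := fun j => if j.val < k.val then 1 else 0

theorem indexWeight_stdIndex {n : ℕ} (k : Fin (n + 1)) : indexWeight (stdIndex (n := n) k) = k := by
  ext
  have hk : k.val ≤ n := Nat.le_of_lt_succ k.isLt
  simp [indexWeight, stdIndex, Fintype.card_subtype, Fin.card_filter_val_lt, hk]

theorem indexWeight_comp_perm {n : ℕ} (a : Fin n → Fin 2) (σ : Equiv.Perm (Fin n)) :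
    indexWeight (a ∘ σ) = indexWeight a :=
  Fin.ext (Fintype.card_congr (σ.subtypeEquiv (p := fun j => (a ∘ σ) j = 1)
    (q := fun j => a j = 1) fun _ => Iff.rfl))

theorem exists_perm_of_indexWeight_eq {n : ℕ} {a a' : Fin n → Fin 2}
    (h : indexWeight a = indexWeight a') : ∃ σ : Equiv.Perm (Fin n), a' ∘ σ = a := by
  have h₁ : Fintype.card {j // a j = 1} = Fintype.card {j // a' j = 1} := congrArg Fin.val h
  have h₀ : Fintype.card {j // a j = 0} = Fintype.card {j // a' j = 0} := by
    have key (c : Fin n → Fin 2) :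
        Fintype.card {j // c j = 0} = Fintype.card (Fin n) - Fintype.card {j // c j = 1} := by
      rw [← Fintype.card_subtype_compl]
      exact Fintype.card_congr (Equiv.subtypeEquivRight fun j => by omega)
    rw [key, key, h₁]
  have e (c : Fin 2) : Nonempty ({j // a j = c} ≃ {j // a' j = c}) := by
    fin_cases c
    · exact ⟨Fintype.equivOfCardEq h₀⟩
    · exact ⟨Fintype.equivOfCardEq h₁⟩
  exact ⟨Equiv.ofFiberEquiv fun c => (e c).some, funext fun j => Equiv.ofFiberEquiv_map _ j⟩

/-- A symmetric tensor is determined by one coefficient for each weight. -/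
def symmTensorsEquiv (n : ℕ) : symmTensors n ≃ₗ[ℂ] (Fin (n + 1) → ℂ) where
  toFun T k := T.1 (stdIndex k)
  map_add' _ _ := rfl
  map_smul' _ _ := rfl
  invFun f := ⟨fun a => f (indexWeight a), mem_symmTensors.2 fun σ a => by
    rw [indexWeight_comp_perm]⟩
  left_inv T := by
    ext a
    obtain ⟨σ, hσ⟩ := exists_perm_of_indexWeight_eq (indexWeight_stdIndex (indexWeight a))
    exact (congrArg T.1 hσ).symm.trans (mem_symmTensors.1 T.2 σ a)
  right_inv f := funext fun k => congrArg f (indexWeight_stdIndex k)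


/-- for `n ≥ 1`, the intersection `⋂_{i=1}^{n-1} ker h_i` of the
kernels of the contractions `h_i : V^{⊗n} → V^{⊗(n-2)}` equals the subspace of
symmetric tensors in `V^{⊗n}`, and this subspace has dimension `n + 1`.
(This computes `H⁰(C_n) ≅ Sym^n(V_1) ≅ V_n`.) -/
theorem inter_ker_contract_eq_symm (n : ℕ) (hn : 1 ≤ n) :
    (⨅ i : Fin (n - 1), LinearMap.ker (contractPos n i)) = symmTensors n ∧
    Module.finrank ℂ (symmTensors n) = n + 1 := by
  obtain ⟨m, rfl⟩ := Nat.exists_eq_add_of_le' hn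
  refine ⟨iInf_ker_contractPos_eq_symmTensors m, ?_⟩
  rw [(symmTensorsEquiv (m + 1)).finrank_eq, Module.finrank_fin_fun]
end

section
/- Fix n ≥ 1 and let V = ℂ². For 0 ≤ k ≤ ⌊n/2⌋ let I_k be the set of k-pairings of n dots, and for s ∈ I_k let V^s := V^{⊗(n-2k)}, thought of as the tensor product of copies of V indexed by the single (unpaired) dots of s in increasing order. For an inclusion of pairings s ⊂ s' with |s'| = |s| + 1, let h_{s',s} : V^s → V^{s'} be the contraction applying the determinant form ω to the two tensor factors corresponding to the unique pair in s' \ s, and let (s, s') be the number of pairs of s lying entirely to the left of that new pair. Define C_n^k := ⊕_{s ∈ I_k} V^s and d^k : C_n^k → C_n^{k+1} as the sum, over all inclusions s ⊂ s' with s ∈ I_k, s' ∈ I_{k+1}, of (-1)^{(s,s')} h_{s',s}. Then d^{k+1} ∘ d^k = 0 for all k, i.e. (C_n, d) is a cochain complex. -/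
/-! ## Pairings of `n` dots and the complex `C_n`

Dots are `0, 1, …, n-1` (0-indexed). A `k`-pairing is recorded by the set of
left endpoints `i` of its pairs `{i, i+1}`; disjointness of the pairs means no
two recorded endpoints are consecutive. The tensor power `(ℂ²)^{⊗(n-2k)}`
attached to a pairing `s` is modelled as the space of coefficient functions
`({single dots of s} → Fin 2) → ℂ`. -/

/-- `s` is (the set of left endpoints of) a `k`-pairing of `n` dots. -/
def IsPairing (n k : ℕ) (s : Finset ℕ) : Prop :=
  s ⊆ Finset.range (n - 1) ∧ s.card = k ∧ ∀ i ∈ s, i + 1 ∉ s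

/-- The single (unpaired) dots of a pairing `s` of `n` dots. -/
def singles (n : ℕ) (s : Finset ℕ) : Finset ℕ :=
  (Finset.range n).filter (fun j => j ∉ s ∧ ∀ i ∈ s, j ≠ i + 1)

/-- The tensor product `V^s` of copies of `V = ℂ²` indexed by the single dots
of `s` (in increasing order), as a space of coefficient functions. -/
abbrev TensorV (n : ℕ) (s : Finset ℕ) : Type :=
  ({j // j ∈ singles n s} → Fin 2) → ℂ

lemma mem_singles_of_erase {n m : ℕ} {s : Finset ℕ} {j : ℕ}
    (hj : j ∈ singles n (s.erase m)) (h1 : j ≠ m) (h2 : j ≠ m + 1) :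
    j ∈ singles n s := by
  simp only [singles, Finset.mem_filter, Finset.mem_range, Finset.mem_erase] at hj ⊢
  obtain ⟨hjn, hjs, hall⟩ := hj
  exact ⟨hjn, fun hs => hjs ⟨h1, hs⟩, fun i hi => by
    by_cases him : i = m
    · subst him; exact h2
    · exact hall i ⟨him, hi⟩⟩

/-- Extension of a multi-index on the single dots of `s` to a multi-index on
the single dots of `s.erase m`, putting `x` at dot `m` and `y` at dot `m+1`. -/
def extendAt (n m : ℕ) (s : Finset ℕ) (x y : Fin 2)
    (b : {j // j ∈ singles n s} → Fin 2) : {j // j ∈ singles n (s.erase m)} → Fin 2 :=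
  fun j => if h1 : j.val = m then x else if h2 : j.val = m + 1 then y
    else b ⟨j.val, mem_singles_of_erase j.2 h1 h2⟩

/-- The contraction `h_{s,s \ {m}} : V^{s.erase m} → V^{s}` applying the
determinant form `ω(v,w) = v₁w₂ - v₂w₁` to the two adjacent tensor factors
(dots `m` and `m+1`) forming the new pair, and keeping the remaining factors
in order. -/
def contractAt (n m : ℕ) (s : Finset ℕ) (T : TensorV n (s.erase m)) :
    TensorV n s :=
  fun b => T (extendAt n m s 0 1 b) - T (extendAt n m s 1 0 b)

/-- The `k`-th term `C_n^k = ⊕_{s ∈ I_k} V^s` of the complex `C_n`. -/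
abbrev ChainC (n k : ℕ) : Type :=
  ∀ s : {s : Finset ℕ // IsPairing n k s}, TensorV n s.val

lemma erase_isPairing {n k : ℕ} {s : Finset ℕ} (hs : IsPairing n (k + 1) s)
    {m : ℕ} (hm : m ∈ s) : IsPairing n k (s.erase m) :=
  ⟨fun i hi => hs.1 (Finset.mem_of_mem_erase hi),
   by rw [Finset.card_erase_of_mem hm, hs.2.1]; rfl,
   fun i hi hc => hs.2.2 i (Finset.mem_of_mem_erase hi) (Finset.mem_of_mem_erase hc)⟩

/-- The differential `d^k : C_n^k → C_n^{k+1}`: the sum over all inclusions of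
pairings `s ⊂ s'` (with `s' ∈ I_{k+1}`, `s = s'.erase m` for the left endpoint
`m` of the new pair) of `(-1)^{(s,s')} h_{s',s}`, where `(s,s')` is the number
of pairs of `s` lying entirely to the left of the new pair `{m, m+1}`. -/
noncomputable def chainD (n k : ℕ) (f : ChainC n k) : ChainC n (k + 1) :=
  fun s' b => ∑ m ∈ s'.val.attach,
    (-1 : ℂ) ^ (((s'.val.erase m.val).filter (fun i => i + 1 < m.val)).card) *
      contractAt n m.val s'.val (f ⟨s'.val.erase m.val, erase_isPairing s'.2 m.2⟩) b

/-- The value of a chain at a pairing and a multi-index depends only on the pairing as a set and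
on the values of the multi-index. -/
lemma ChainC.apply_congr {n k : ℕ} (f : ChainC n k)
    {s t : {s : Finset ℕ // IsPairing n k s}} (hst : s.val = t.val)
    {a : {j // j ∈ singles n s.val} → Fin 2} {b : {j // j ∈ singles n t.val} → Fin 2}
    (hab : ∀ j hs ht, a ⟨j, hs⟩ = b ⟨j, ht⟩) : f s a = f t b := by
  obtain rfl : s = t := Subtype.ext hst
  exact congrArg (f s) (funext fun j => hab j.1 j.2 j.2)

/-- Extensions at two disjoint pairs commute. -/
lemma extendAt_comm {n p q : ℕ} {s : Finset ℕ} (hpq : p + 1 < q) (x y z w : Fin 2)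
    (b : {j // j ∈ singles n s} → Fin 2) (j : ℕ)
    (h : j ∈ singles n ((s.erase p).erase q)) (h' : j ∈ singles n ((s.erase q).erase p)) :
    extendAt n q (s.erase p) z w (extendAt n p s x y b) ⟨j, h⟩ =
      extendAt n p (s.erase q) x y (extendAt n q s z w b) ⟨j, h'⟩ := by
  simp only [extendAt]
  split_ifs <;> first | rfl | omega

/-- The number of elements of `s` whose pair lies to the left of the pair at `q`, when an element
`p` to the left is discarded. -/
lemma card_filter_erase_left {p q : ℕ} {s : Finset ℕ} (hp : p ∈ s) (hpq : p + 1 < q) :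
    ((s.erase q).filter (fun i => i + 1 < q)).card =
      (((s.erase p).erase q).filter (fun i => i + 1 < q)).card + 1 := by
  rw [Finset.erase_right_comm, Finset.filter_erase _ p, Finset.card_erase_add_one]
  simp only [Finset.mem_filter, Finset.mem_erase]
  exact ⟨⟨by omega, hp⟩, hpq⟩

/-- Discarding an element `q` to the right of `p` does not change the pairs to the left of `p`. -/
lemma filter_erase_right {p q : ℕ} {s : Finset ℕ} (hpq : p < q) :
    ((s.erase q).erase p).filter (fun i => i + 1 < p) =
      (s.erase p).filter (fun i => i + 1 < p) := by
  ext i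
  simp only [Finset.mem_filter, Finset.mem_erase]
  constructor
  · rintro ⟨⟨hne, -, hs⟩, hlt⟩
    exact ⟨⟨hne, hs⟩, hlt⟩
  · rintro ⟨⟨hne, hs⟩, hlt⟩
    exact ⟨⟨hne, by omega, hs⟩, hlt⟩

/-- The summand of `chainD n (k + 1) (chainD n k f)` obtained by adding first the pair at `q` and
then the pair at `p`. -/
noncomputable def chainDDTerm {n k : ℕ} (f : ChainC n k)
    (s : {s : Finset ℕ // IsPairing n (k + 1 + 1) s}) (b : {j // j ∈ singles n s.val} → Fin 2)
    (p q : ℕ) (hp : p ∈ s.val) (hq : q ∈ s.val.erase p) : ℂ :=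
  (-1 : ℂ) ^ ((s.val.erase p).filter (fun i => i + 1 < p)).card *
    ((-1 : ℂ) ^ (((s.val.erase p).erase q).filter (fun i => i + 1 < q)).card *
      contractAt n p s.val (contractAt n q (s.val.erase p)
        (f ⟨(s.val.erase p).erase q, erase_isPairing (erase_isPairing s.2 hp) hq⟩)) b)

/-- Adding two pairs in the two possible orders gives opposite contributions. -/
lemma chainDDTerm_add_swap_of_lt {n k : ℕ} (f : ChainC n k)
    (s : {s : Finset ℕ // IsPairing n (k + 1 + 1) s}) (b : {j // j ∈ singles n s.val} → Fin 2)
    {p q : ℕ} (hp : p ∈ s.val) (hq : q ∈ s.val.erase p) (hq' : q ∈ s.val)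
    (hp' : p ∈ s.val.erase q) (hlt : p < q) :
    chainDDTerm f s b p q hp hq + chainDDTerm f s b q p hq' hp' = 0 := by
  have hpq : p + 1 < q :=
    lt_of_le_of_ne hlt fun h => s.2.2.2 p hp (h ▸ hq')
  have key (x y z w : Fin 2) :
      f ⟨(s.val.erase p).erase q, erase_isPairing (erase_isPairing s.2 hp) hq⟩
          (extendAt n q (s.val.erase p) z w (extendAt n p s.val x y b)) =
        f ⟨(s.val.erase q).erase p, erase_isPairing (erase_isPairing s.2 hq') hp'⟩
          (extendAt n p (s.val.erase q) x y (extendAt n q s.val z w b)) :=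
    f.apply_congr Finset.erase_right_comm (extendAt_comm hpq x y z w b)
  simp only [chainDDTerm, contractAt, key, card_filter_erase_left hp hpq,
    filter_erase_right hlt]
  ring

lemma chainDDTerm_add_swap {n k : ℕ} (f : ChainC n k)
    (s : {s : Finset ℕ // IsPairing n (k + 1 + 1) s}) (b : {j // j ∈ singles n s.val} → Fin 2)
    {p q : ℕ} (hp : p ∈ s.val) (hq : q ∈ s.val.erase p) (hq' : q ∈ s.val)
    (hp' : p ∈ s.val.erase q) :
    chainDDTerm f s b p q hp hq + chainDDTerm f s b q p hq' hp' = 0 := by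
  rcases (Finset.ne_of_mem_erase hp').lt_or_gt with h | h
  · exact chainDDTerm_add_swap_of_lt f s b hp hq hq' hp' h
  · rw [add_comm]
    exact chainDDTerm_add_swap_of_lt f s b hq' hp' hp hq h

lemma chainD_chainD_apply {n k : ℕ} (f : ChainC n k)
    (s : {s : Finset ℕ // IsPairing n (k + 1 + 1) s})
    (b : {j // j ∈ singles n s.val} → Fin 2) :
    chainD n (k + 1) (chainD n k f) s b =
      ∑ p ∈ s.val.attach, ∑ q ∈ (s.val.erase p.val).attach,
        chainDDTerm f s b p.val q.val p.2 q.2 := by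
  refine Finset.sum_congr rfl fun p _ => ?_
  simp only [chainDDTerm, contractAt, chainD]
  rw [← Finset.sum_sub_distrib, Finset.mul_sum]
  refine Finset.sum_congr rfl fun q _ => ?_
  ring

/-- `d^{k+1} ∘ d^k = 0`, i.e. `(C_n, d)` is a cochain complex. -/
theorem chainD_squared (n k : ℕ) (hn : 1 ≤ n) (f : ChainC n k) :
    chainD n (k + 1) (chainD n k f) = 0 := by
  funext s b
  rw [chainD_chainD_apply, Finset.sum_sigma']
  have swap_mem (x : (p : {p // p ∈ s.val}) × {q // q ∈ s.val.erase p.val}) :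
      x.1.val ∈ s.val.erase x.2.val :=
    Finset.mem_erase.2 ⟨(Finset.ne_of_mem_erase x.2.2).symm, x.1.2⟩
  refine Finset.sum_involution
    (fun x _ => ⟨⟨x.2.val, Finset.mem_of_mem_erase x.2.2⟩, ⟨x.1.val, swap_mem x⟩⟩)
    (fun x _ => chainDDTerm_add_swap f s b _ _ _ _) (fun x _ _ h => ?_) (fun x _ => by simp)
    (fun x _ => rfl)
  exact Finset.ne_of_mem_erase x.2.2 (congrArg (fun y => y.1.val) h)
end
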